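/- Let n ≥ m ≥ 3 be integers such that n ≥ m + 2 ≥ 5 or n is odd. Then the Ramsey number of 4-uniform loose paths satisfies R(P^4_n, P^4_m) = 3n + ⌊(m+1)/2⌋. -/

import Mathlib

/-- A copy of the `k`-uniform loose path with `n` edges, all of color `b`
(`true` = red, `false` = blue), in the coloring `col` of the `k`-subsets of `V`.
The path is given by an injective listing `f 0, f 1, …, f (n*(k-1))` of its
vertices, with `i`-th edge `{f (i*(k-1)), …, f (i*(k-1)+k-1)}`. -/
def HasLoosePath {V : Type*} [DecidableEq V] (k n : ℕ) (col : Finset V → Bool)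
    (b : Bool) : Prop :=
  ∃ f : ℕ → V, Set.InjOn f (Set.Iio (n * (k - 1) + 1)) ∧
    ∀ i < n, col ((Finset.range k).image fun j => f (i * (k - 1) + j)) = b

/-- A copy of the `k`-uniform loose cycle with `n` edges, all of color `b`
(`true` = red, `false` = blue), in the coloring `col` of the `k`-subsets of `V`.
The cycle is given by an injective listing `f 0, …, f (n*(k-1) - 1)` of its
vertices, with `i`-th edge `{f (i*(k-1) % (n*(k-1))), …, f ((i*(k-1)+k-1) % (n*(k-1)))}`. -/
def HasLooseCycle {V : Type*} [DecidableEq V] (k n : ℕ) (col : Finset V → Bool)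
    (b : Bool) : Prop :=
  ∃ f : ℕ → V, Set.InjOn f (Set.Iio (n * (k - 1))) ∧
    ∀ i < n, col ((Finset.range k).image fun j => f ((i * (k - 1) + j) % (n * (k - 1)))) = b

/-- `R(P^k_n, P^k_m)`: the least positive `N` such that every red-blue coloring of the
`k`-subsets of an `N`-set contains a red `P^k_n` or a blue `P^k_m`. -/
noncomputable def RamseyPP (k n m : ℕ) : ℕ :=
  sInf {N | 0 < N ∧ ∀ col : Finset (Fin N) → Bool,
    HasLoosePath k n col true ∨ HasLoosePath k m col false}

/-- `R(P^k_n, C^k_m)`. -/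
noncomputable def RamseyPC (k n m : ℕ) : ℕ :=
  sInf {N | 0 < N ∧ ∀ col : Finset (Fin N) → Bool,
    HasLoosePath k n col true ∨ HasLooseCycle k m col false}

/-- `R(C^k_n, P^k_m)`. -/
noncomputable def RamseyCP (k n m : ℕ) : ℕ :=
  sInf {N | 0 < N ∧ ∀ col : Finset (Fin N) → Bool,
    HasLooseCycle k n col true ∨ HasLoosePath k m col false}

/-- `R(C^k_n, C^k_m)`. -/
noncomputable def RamseyCC (k n m : ℕ) : ℕ :=
  sInf {N | 0 < N ∧ ∀ col : Finset (Fin N) → Bool,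
    HasLooseCycle k n col true ∨ HasLooseCycle k m col false}


/-- A loose 4-uniform path of colour `c` with `n` edges, ending at the given vertex and contained
in the given set. -/
inductive LP {V : Type*} [DecidableEq V] (col : Finset V → Bool) (c : Bool) :
    ℕ → V → Finset V → Prop
  | nil (v : V) (D : Finset V) (h : v ∈ D) : LP col c 0 v D
  | snoc (n : ℕ) (e x y z : V) (D D' : Finset V) (h : LP col c n e D)
      (hx : x ∉ D) (hy : y ∉ D) (hz : z ∉ D) (hxy : x ≠ y) (hxz : x ≠ z) (hyz : y ≠ z)
      (hc : col {e, x, y, z} = c) (hD : D ⊆ D') (hx' : x ∈ D') (hy' : y ∈ D') (hz' : z ∈ D') :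
      LP col c (n + 1) z D'

section
set_option linter.unusedSimpArgs false
variable {V : Type*} [DecidableEq V] {col : Finset V → Bool} {c : Bool}

theorem LP.mono {n : ℕ} {e : V} {D D' : Finset V} (h : LP col c n e D) (hD : D ⊆ D') :
    LP col c n e D' := by
  cases h with
  | nil _ _ h => exact LP.nil _ _ (hD h)
  | snoc n e x y z D0 _ h hx hy hz hxy hxz hyz hc h0 hx' hy' hz' =>
    exact LP.snoc _ _ _ _ _ D0 D' h hx hy hz hxy hxz hyz hc (h0.trans hD) (hD hx') (hD hy') (hD hz')

theorem LP.exists_fun {n : ℕ} {e : V} {D : Finset V} (h : LP col c n e D) :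
    ∃ f : ℕ → V, Set.InjOn f (Set.Iio (3 * n + 1)) ∧ f (3 * n) = e ∧
      (∀ i < 3 * n + 1, f i ∈ D) ∧
      ∀ i < n, col {f (3 * i), f (3 * i + 1), f (3 * i + 2), f (3 * i + 3)} = c := by
  induction h with
  | nil v D h =>
    refine ⟨fun _ => v, ?_, rfl, fun _ _ => h, fun i hi => absurd hi (by omega)⟩
    intro i hi j hj _
    simp only [Set.mem_Iio] at hi hj
    omega
  | snoc n e x y z D D' h hx hy hz hxy hxz hyz hc hD hx' hy' hz' ih =>
    obtain ⟨f, hf, he, hfD, hcol⟩ := ih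
    refine ⟨fun i => if i < 3 * n + 1 then f i else if i = 3 * n + 1 then x else
      if i = 3 * n + 2 then y else z, ?_, ?_, ?_, ?_⟩
    · intro i hi j hj hij
      simp only [Set.mem_Iio] at hi hj
      have key : ∀ k, k < 3 * n + 1 → f k ≠ x ∧ f k ≠ y ∧ f k ≠ z := fun k hk =>
        ⟨fun h => hx (h ▸ hfD k hk), fun h => hy (h ▸ hfD k hk), fun h => hz (h ▸ hfD k hk)⟩
      have key' : ∀ k, k < 3 * n + 1 → x ≠ f k ∧ y ≠ f k ∧ z ≠ f k := fun k hk =>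
        ⟨(key k hk).1.symm, (key k hk).2.1.symm, (key k hk).2.2.symm⟩
      dsimp only at hij
      by_cases h1 : i < 3 * n + 1
      · by_cases h2 : j < 3 * n + 1
        · simp only [h1, h2, if_true] at hij
          exact hf h1 h2 hij
        · have := key i h1
          simp only [h1, h2, if_true, if_false] at hij
          split_ifs at hij <;> simp_all
      · by_cases h2 : j < 3 * n + 1
        · have := key' j h2
          simp only [h1, h2, if_true, if_false] at hij
          split_ifs at hij <;> simp_all
        · simp only [h1, h2, if_false] at hij
          have := hxy.symm
          have := hxz.symm
          have := hyz.symm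
          split_ifs at hij <;> first | omega | contradiction
    · simp only [show ¬ (3 * (n + 1) < 3 * n + 1) by omega,
        show ¬ (3 * (n + 1) = 3 * n + 1) by omega,
        show ¬ (3 * (n + 1) = 3 * n + 2) by omega, if_false]
    · intro i hi
      dsimp only
      split_ifs with h1
      · exact hD (hfD i h1)
      all_goals assumption
    · intro i hi
      rcases Nat.lt_succ_iff_lt_or_eq.mp hi with h | h
      · have := hcol i h
        simpa only [show 3 * i < 3 * n + 1 by omega, show 3 * i + 1 < 3 * n + 1 by omega,
          show 3 * i + 2 < 3 * n + 1 by omega, show 3 * i + 3 < 3 * n + 1 by omega, if_true]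
          using this
      · subst h
        simp only [show 3 * i < 3 * i + 1 by omega, show ¬ (3 * i + 1 < 3 * i + 1) by omega,
          show ¬ (3 * i + 2 < 3 * i + 1) by omega, show ¬ (3 * i + 3 < 3 * i + 1) by omega,
          show ¬ (3 * i + 2 = 3 * i + 1) by omega, show ¬ (3 * i + 3 = 3 * i + 1) by omega,
          show ¬ (3 * i + 3 = 3 * i + 2) by omega, if_true, if_false, he]
        exact hc

theorem image_range_four (f : ℕ → V) (i : ℕ) :
    ((Finset.range 4).image fun j => f (i * (4 - 1) + j)) =
      {f (3 * i), f (3 * i + 1), f (3 * i + 2), f (3 * i + 3)} := by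
  ext v
  simp only [Finset.mem_image, Finset.mem_range, Finset.mem_insert, Finset.mem_singleton]
  constructor
  · rintro ⟨j, hj, rfl⟩
    have : i * (4 - 1) = 3 * i := by omega
    rw [this]
    interval_cases j <;> simp
  · have : i * (4 - 1) = 3 * i := by omega
    rw [this]
    rintro (rfl | rfl | rfl | rfl)
    · exact ⟨0, by omega, rfl⟩
    · exact ⟨1, by omega, rfl⟩
    · exact ⟨2, by omega, rfl⟩
    · exact ⟨3, by omega, rfl⟩

theorem hasLoosePath_iff (n : ℕ) : HasLoosePath 4 n col c ↔
    ∃ f : ℕ → V, Set.InjOn f (Set.Iio (3 * n + 1)) ∧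
      ∀ i < n, col {f (3 * i), f (3 * i + 1), f (3 * i + 2), f (3 * i + 3)} = c := by
  unfold HasLoosePath
  simp only [image_range_four]
  have : n * (4 - 1) + 1 = 3 * n + 1 := by omega
  rw [this]

theorem LP.has {n : ℕ} {e : V} {D : Finset V} (h : LP col c n e D) : HasLoosePath 4 n col c := by
  obtain ⟨f, h1, _, _, h2⟩ := h.exists_fun
  exact (hasLoosePath_iff n).2 ⟨f, h1, h2⟩

theorem HasLoosePath.mono {n m : ℕ} (h : HasLoosePath 4 n col c) (hmn : m ≤ n) :
    HasLoosePath 4 m col c := by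
  rw [hasLoosePath_iff] at h ⊢
  obtain ⟨f, h1, h2⟩ := h
  refine ⟨f, h1.mono ?_, fun i hi => h2 i (by omega)⟩
  intro i hi
  simp only [Set.mem_Iio] at hi ⊢
  omega

/-- systems of distinct representatives for three sets -/
theorem sdr3 (A B C : Finset V) (hA : 2 ≤ A.card) (hB : 2 ≤ B.card) (hC : 2 ≤ C.card)
    (hAB : 3 ≤ (A ∪ B).card) : ∃ a ∈ A, ∃ b ∈ B, ∃ c ∈ C, a ≠ b ∧ a ≠ c ∧ b ≠ c := by
  obtain ⟨p, hp, q, hq, hpq⟩ := Finset.one_lt_card.1 (show 1 < C.card by omega)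
  by_contra hcon
  push Not at hcon
  -- any distinct pair a ∈ A, b ∈ B must be {p,q}
  have key : ∀ a ∈ A, ∀ b ∈ B, a ≠ b → (a = p ∧ b = q) ∨ (a = q ∧ b = p) := by
    intro a ha b hb hab
    have h1 := hcon a ha b hb p hp hab
    have h2 := hcon a ha b hb q hq hab
    by_cases hap : a = p
    · subst hap
      left; exact ⟨rfl, h2 hpq⟩
    · have := h1 hap
      subst this
      by_cases haq : a = q
      · right; exact ⟨haq, rfl⟩
      · exact absurd (h2 haq) hpq
  have hsub : A ∪ B ⊆ {p, q} := by
    intro x hx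
    simp only [Finset.mem_insert, Finset.mem_singleton]
    rcases Finset.mem_union.1 hx with hx | hx
    · obtain ⟨b, hb, hbx⟩ := Finset.exists_mem_ne (show 1 < B.card by omega) x
      rcases key x hx b hb hbx.symm with h | h
      · exact Or.inl h.1
      · exact Or.inr h.1
    · obtain ⟨a, ha, hax⟩ := Finset.exists_mem_ne (show 1 < A.card by omega) x
      rcases key a ha x hx hax with h | h
      · exact Or.inr h.2
      · exact Or.inl h.2
  have := (Finset.card_le_card hsub).trans Finset.card_le_two
  omega

/-- red neighbours in `W` of a triple -/
def RN (col : Finset V → Bool) (W : Finset V) (x y z : V) : Finset V :=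
  W.filter fun w => col {w, x, y, z} = true

theorem RN_swap (W : Finset V) (x y z : V) : RN col W x y z = RN col W y x z := by
  unfold RN
  congr 1; ext w
  rw [Finset.insert_comm x y]

theorem RN_swap2 (W : Finset V) (x y z : V) : RN col W x y z = RN col W x z y := by
  unfold RN
  congr 1; ext w
  rw [Finset.pair_comm y z]

/-- The conclusion of the local lemma. -/
def LocalConcl (col : Finset V → Bool) (W : Finset V) (g1 g2 g3 g4 g5 g6 g7 : V) : Prop :=
  ∃ E : Finset V, E.card ≤ 2 ∧ ∃ v, (v = g5 ∨ v = g6 ∨ v = g7) ∧ ∃ s1 s2 x t1 t2 : V,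
    [s1, s2, x, t1, t2].Nodup ∧
    (∀ p ∈ [s1, s2, x, t1, t2], p ∈ [g1, g2, g3, g4, g5, g6, g7] ∧ p ≠ v) ∧
    ∀ w ∈ W, w ∉ E → col {w, s1, s2, x} = false ∧ col {x, t1, t2, w} = false

theorem localConcl_mk (W : Finset V) (g1 g2 g3 g4 g5 g6 g7 : V) (s1 s2 x t1 t2 v : V)
    (hv : v = g5 ∨ v = g6 ∨ v = g7) (hn : [s1, s2, x, t1, t2].Nodup)
    (hp : ∀ p ∈ [s1, s2, x, t1, t2], p ∈ [g1, g2, g3, g4, g5, g6, g7] ∧ p ≠ v)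
    (hc : (RN col W s1 s2 x ∪ RN col W x t1 t2).card ≤ 2) :
    LocalConcl col W g1 g2 g3 g4 g5 g6 g7 := by
  refine ⟨_, hc, v, hv, s1, s2, x, t1, t2, hn, hp, fun w hw hE => ?_⟩
  simp only [RN, Finset.mem_union, Finset.mem_filter, not_or, not_and, Bool.not_eq_true] at hE
  refine ⟨hE.1 hw, ?_⟩
  have h := hE.2 hw
  have h' : ({w, x, t1, t2} : Finset V) = {x, t1, t2, w} := by
    ext; simp only [Finset.mem_insert, Finset.mem_singleton]; tauto
  rwa [h'] at h

theorem card_union_le_two {A B : Finset V} (hA : A.card ≤ 1) (hB : B.card ≤ 1) :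
    (A ∪ B).card ≤ 2 := (Finset.card_union_le A B).trans (by omega)

theorem local_lemma (W : Finset V) (g1 g2 g3 g4 g5 g6 g7 : V)
    (hg : [g1, g2, g3, g4, g5, g6, g7].Nodup)
    (H : ∀ a x b y d : V, [a, x, b, y, d].Nodup →
      (∀ p ∈ [a, x, b, y, d], p ∈ [g2, g3, g4, g5, g6]) →
      ∀ w1 ∈ W, ∀ w2 ∈ W, ∀ w3 ∈ W, w1 ≠ w2 → w1 ≠ w3 → w2 ≠ w3 →
      ¬ (col {w1, g1, a, x} = true ∧ col {w2, x, b, y} = true ∧ col {w3, y, d, g7} = true)) :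
    LocalConcl col W g1 g2 g3 g4 g5 g6 g7 := by
  by_contra hcon
  have step : ∀ a x b y d : V, [a, x, b, y, d].Nodup →
      (∀ p ∈ [a, x, b, y, d], p ∈ [g2, g3, g4, g5, g6]) →
      (RN col W g1 a x).card ≤ 1 ∨ (RN col W x b y).card ≤ 1 ∨ (RN col W y d g7).card ≤ 1 := by
    intro a x b y d hn hp
    by_contra hc
    push Not at hc
    by_cases h3 : (RN col W g1 a x ∪ RN col W x b y).card ≤ 2
    · refine hcon (localConcl_mk W g1 g2 g3 g4 g5 g6 g7 g1 a x b y g7 (by simp) ?_ ?_ h3)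
      · simp only [List.nodup_cons, List.mem_cons, List.not_mem_nil, or_false, forall_eq_or_imp, forall_eq, not_or, List.nodup_nil, not_false_eq_true, and_true] at hg hn hp ⊢
        clear H hcon h3 hc
        grind
      · simp only [List.nodup_cons, List.mem_cons, List.not_mem_nil, or_false, forall_eq_or_imp, forall_eq, not_or, List.nodup_nil, not_false_eq_true, and_true] at hg hn hp ⊢
        clear H hcon h3 hc
        grind
    · obtain ⟨w1, h1, w2, h2, w3, h3, h12, h13, h23⟩ :=
        sdr3 _ _ (RN col W y d g7) hc.1 hc.2.1 hc.2.2 (by omega)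
      simp only [RN, Finset.mem_filter] at h1 h2 h3
      exact H a x b y d hn hp w1 h1.1 w2 h2.1 w3 h3.1 h12 h13 h23 ⟨h1.2, h2.2, h3.2⟩
  have pair : ∀ s1 s2 x t1 t2 v : V, (v = g5 ∨ v = g6 ∨ v = g7) → [s1, s2, x, t1, t2].Nodup →
      (∀ p ∈ [s1, s2, x, t1, t2], p ∈ [g1, g2, g3, g4, g5, g6, g7] ∧ p ≠ v) →
      (RN col W s1 s2 x).card ≤ 1 → (RN col W x t1 t2).card ≤ 1 → False :=
    fun s1 s2 x t1 t2 v hv hn hp h1 h2 =>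
      hcon (localConcl_mk W g1 g2 g3 g4 g5 g6 g7 s1 s2 x t1 t2 v hv hn hp (card_union_le_two h1 h2))
  clear H hcon
  simp only [List.nodup_cons, List.mem_cons, List.not_mem_nil, or_false, forall_eq_or_imp, forall_eq, not_or, List.nodup_nil, not_false_eq_true, and_true] at hg step
  have le1 : ∀ {x y z x' y' z' : V}, ({x', y', z'} : Finset V) = {x, y, z} →
      (RN col W x y z).card ≤ 1 → (RN col W x' y' z').card ≤ 1 := by
    intro x y z x' y' z' h h'
    unfold RN at *
    rwa [h]
  rcases step g5 g2 g6 g3 g4 (by clear pair step; grind) (by simp) with h | h | h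
  · rcases step g3 g6 g2 g4 g5 (by clear pair step; grind) (by simp) with h' | h' | h'
    · exact pair g2 g5 g1 g3 g6 g7 (by simp)
        (by simp only [List.nodup_cons, List.mem_cons, List.not_mem_nil, or_false, forall_eq_or_imp, forall_eq, not_or, List.nodup_nil, not_false_eq_true, and_true]; clear pair step; grind)
        (by simp only [List.nodup_cons, List.mem_cons, List.not_mem_nil, or_false, forall_eq_or_imp, forall_eq, not_or, List.nodup_nil, not_false_eq_true, and_true]; clear pair step; grind)
        (le1 (by ext; simp only [Finset.mem_insert, Finset.mem_singleton] <;> tauto) h)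
        (le1 (by ext; simp only [Finset.mem_insert, Finset.mem_singleton] <;> tauto) h')
    · exact pair g1 g5 g2 g6 g4 g7 (by simp)
        (by simp only [List.nodup_cons, List.mem_cons, List.not_mem_nil, or_false, forall_eq_or_imp, forall_eq, not_or, List.nodup_nil, not_false_eq_true, and_true]; clear pair step; grind)
        (by simp only [List.nodup_cons, List.mem_cons, List.not_mem_nil, or_false, forall_eq_or_imp, forall_eq, not_or, List.nodup_nil, not_false_eq_true, and_true]; clear pair step; grind)
        (le1 (by ext; simp only [Finset.mem_insert, Finset.mem_singleton] <;> tauto) h)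
        (le1 (by ext; simp only [Finset.mem_insert, Finset.mem_singleton] <;> tauto) h')
    · exact pair g1 g2 g5 g4 g7 g6 (by simp)
        (by simp only [List.nodup_cons, List.mem_cons, List.not_mem_nil, or_false, forall_eq_or_imp, forall_eq, not_or, List.nodup_nil, not_false_eq_true, and_true]; clear pair step; grind)
        (by simp only [List.nodup_cons, List.mem_cons, List.not_mem_nil, or_false, forall_eq_or_imp, forall_eq, not_or, List.nodup_nil, not_false_eq_true, and_true]; clear pair step; grind)
        (le1 (by ext; simp only [Finset.mem_insert, Finset.mem_singleton] <;> tauto) h)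
        (le1 (by ext; simp only [Finset.mem_insert, Finset.mem_singleton] <;> tauto) h')
  · rcases step g2 g5 g3 g4 g6 (by clear pair step; grind) (by simp) with h' | h' | h'
    · exact pair g3 g6 g2 g1 g5 g7 (by simp)
        (by simp only [List.nodup_cons, List.mem_cons, List.not_mem_nil, or_false, forall_eq_or_imp, forall_eq, not_or, List.nodup_nil, not_false_eq_true, and_true]; clear pair step; grind)
        (by simp only [List.nodup_cons, List.mem_cons, List.not_mem_nil, or_false, forall_eq_or_imp, forall_eq, not_or, List.nodup_nil, not_false_eq_true, and_true]; clear pair step; grind)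
        (le1 (by ext; simp only [Finset.mem_insert, Finset.mem_singleton] <;> tauto) h)
        (le1 (by ext; simp only [Finset.mem_insert, Finset.mem_singleton] <;> tauto) h')
    · exact pair g2 g6 g3 g5 g4 g7 (by simp)
        (by simp only [List.nodup_cons, List.mem_cons, List.not_mem_nil, or_false, forall_eq_or_imp, forall_eq, not_or, List.nodup_nil, not_false_eq_true, and_true]; clear pair step; grind)
        (by simp only [List.nodup_cons, List.mem_cons, List.not_mem_nil, or_false, forall_eq_or_imp, forall_eq, not_or, List.nodup_nil, not_false_eq_true, and_true]; clear pair step; grind)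
        (le1 (by ext; simp only [Finset.mem_insert, Finset.mem_singleton] <;> tauto) h)
        (le1 (by ext; simp only [Finset.mem_insert, Finset.mem_singleton] <;> tauto) h')
    · exact pair g2 g3 g6 g4 g7 g5 (by simp)
        (by simp only [List.nodup_cons, List.mem_cons, List.not_mem_nil, or_false, forall_eq_or_imp, forall_eq, not_or, List.nodup_nil, not_false_eq_true, and_true]; clear pair step; grind)
        (by simp only [List.nodup_cons, List.mem_cons, List.not_mem_nil, or_false, forall_eq_or_imp, forall_eq, not_or, List.nodup_nil, not_false_eq_true, and_true]; clear pair step; grind)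
        (le1 (by ext; simp only [Finset.mem_insert, Finset.mem_singleton] <;> tauto) h)
        (le1 (by ext; simp only [Finset.mem_insert, Finset.mem_singleton] <;> tauto) h')
  · rcases step g3 g5 g4 g2 g6 (by clear pair step; grind) (by simp) with h' | h' | h'
    · exact pair g4 g7 g3 g1 g5 g6 (by simp)
        (by simp only [List.nodup_cons, List.mem_cons, List.not_mem_nil, or_false, forall_eq_or_imp, forall_eq, not_or, List.nodup_nil, not_false_eq_true, and_true]; clear pair step; grind)
        (by simp only [List.nodup_cons, List.mem_cons, List.not_mem_nil, or_false, forall_eq_or_imp, forall_eq, not_or, List.nodup_nil, not_false_eq_true, and_true]; clear pair step; grind)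
        (le1 (by ext; simp only [Finset.mem_insert, Finset.mem_singleton] <;> tauto) h)
        (le1 (by ext; simp only [Finset.mem_insert, Finset.mem_singleton] <;> tauto) h')
    · exact pair g3 g7 g4 g5 g2 g6 (by simp)
        (by simp only [List.nodup_cons, List.mem_cons, List.not_mem_nil, or_false, forall_eq_or_imp, forall_eq, not_or, List.nodup_nil, not_false_eq_true, and_true]; clear pair step; grind)
        (by simp only [List.nodup_cons, List.mem_cons, List.not_mem_nil, or_false, forall_eq_or_imp, forall_eq, not_or, List.nodup_nil, not_false_eq_true, and_true]; clear pair step; grind)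
        (le1 (by ext; simp only [Finset.mem_insert, Finset.mem_singleton] <;> tauto) h)
        (le1 (by ext; simp only [Finset.mem_insert, Finset.mem_singleton] <;> tauto) h')
    · exact pair g3 g4 g7 g2 g6 g5 (by simp)
        (by simp only [List.nodup_cons, List.mem_cons, List.not_mem_nil, or_false, forall_eq_or_imp, forall_eq, not_or, List.nodup_nil, not_false_eq_true, and_true]; clear pair step; grind)
        (by simp only [List.nodup_cons, List.mem_cons, List.not_mem_nil, or_false, forall_eq_or_imp, forall_eq, not_or, List.nodup_nil, not_false_eq_true, and_true]; clear pair step; grind)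
        (le1 (by ext; simp only [Finset.mem_insert, Finset.mem_singleton] <;> tauto) h)
        (le1 (by ext; simp only [Finset.mem_insert, Finset.mem_singleton] <;> tauto) h')
end

section
variable {V : Type*} [DecidableEq V] {col : Finset V → Bool}

theorem LP.snoc' {c : Bool} {n : ℕ} {e x y z : V} {D : Finset V} (h : LP col c n e D)
    (hx : x ∉ D) (hy : y ∉ D) (hz : z ∉ D) (hxy : x ≠ y) (hxz : x ≠ z) (hyz : y ≠ z)
    (hc : col {e, x, y, z} = c) : LP col c (n + 1) z (D ∪ {x, y, z}) :=
  LP.snoc n e x y z D _ h hx hy hz hxy hxz hyz hc Finset.subset_union_left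
    (Finset.mem_union_right _ (by simp)) (Finset.mem_union_right _ (by simp))
    (Finset.mem_union_right _ (by simp))

theorem perm1 (u p w x : V) : ({u, p, w, x} : Finset V) = {w, u, p, x} := by
  ext; simp only [Finset.mem_insert, Finset.mem_singleton]; tauto

theorem perm2 (u p w x : V) : ({u, p, w, x} : Finset V) = {x, u, p, w} := by
  ext; simp only [Finset.mem_insert, Finset.mem_singleton]; tauto

/-- vertices of the first `j` edges -/
def img (f : ℕ → V) (j : ℕ) : Finset V := (Finset.range (3 * j + 1)).image f

theorem mem_img {f : ℕ → V} {j : ℕ} {v : V} : v ∈ img f j ↔ ∃ i, i < 3 * j + 1 ∧ f i = v := by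
  simp [img]

theorem f_mem_img (f : ℕ → V) {i j : ℕ} (h : i ≤ 3 * j) : f i ∈ img f j :=
  mem_img.2 ⟨i, by omega, rfl⟩

theorem img_mono (f : ℕ → V) {i j : ℕ} (h : i ≤ j) : img f i ⊆ img f j := by
  intro v hv
  obtain ⟨k, hk, rfl⟩ := mem_img.1 hv
  exact f_mem_img f (by omega)

theorem f_notMem_img {f : ℕ → V} {a i j : ℕ} (hf : Set.InjOn f (Set.Iio (3 * a + 1)))
    (hj : j ≤ a) (hi : 3 * j < i) (hi' : i ≤ 3 * a) : f i ∉ img f j := by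
  intro h
  obtain ⟨k, hk, hki⟩ := mem_img.1 h
  have := hf (show k ∈ Set.Iio (3 * a + 1) by simp only [Set.mem_Iio]; omega)
    (show i ∈ Set.Iio (3 * a + 1) by simp only [Set.mem_Iio]; omega) hki
  omega

theorem f_ne {f : ℕ → V} {a i j : ℕ} (hf : Set.InjOn f (Set.Iio (3 * a + 1)))
    (hi : i ≤ 3 * a) (hj : j ≤ 3 * a) (hij : i ≠ j) : f i ≠ f j := fun h =>
  hij (hf (show i ∈ Set.Iio (3 * a + 1) by simp only [Set.mem_Iio]; omega)
    (show j ∈ Set.Iio (3 * a + 1) by simp only [Set.mem_Iio]; omega) h)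

theorem prefix_exit {f : ℕ → V} {a j : ℕ} {c : Bool} (hf : Set.InjOn f (Set.Iio (3 * a + 1)))
    (hcol : ∀ i < a, col {f (3 * i), f (3 * i + 1), f (3 * i + 2), f (3 * i + 3)} = c)
    (h : LP col c j (f (3 * j)) (img f j)) (hj : j + 1 ≤ a) (v : V)
    (hv : v = f (3 * j + 1) ∨ v = f (3 * j + 2) ∨ v = f (3 * j + 3)) :
    LP col c (j + 1) v (img f (j + 1)) := by
  have n1 := f_notMem_img hf (i := 3 * j + 1) (j := j) (by omega) (by omega) (by omega)
  have n2 := f_notMem_img hf (i := 3 * j + 2) (j := j) (by omega) (by omega) (by omega)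
  have n3 := f_notMem_img hf (i := 3 * j + 3) (j := j) (by omega) (by omega) (by omega)
  have d12 := f_ne hf (i := 3 * j + 1) (j := 3 * j + 2) (by omega) (by omega) (by omega)
  have d13 := f_ne hf (i := 3 * j + 1) (j := 3 * j + 3) (by omega) (by omega) (by omega)
  have d23 := f_ne hf (i := 3 * j + 2) (j := 3 * j + 3) (by omega) (by omega) (by omega)
  have m1 := f_mem_img f (i := 3 * j + 1) (j := j + 1) (by omega)
  have m2 := f_mem_img f (i := 3 * j + 2) (j := j + 1) (by omega)
  have m3 := f_mem_img f (i := 3 * j + 3) (j := j + 1) (by omega)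
  have hc := hcol j (by omega)
  have hm := img_mono f (show j ≤ j + 1 by omega)
  rcases hv with rfl | rfl | rfl
  · refine LP.snoc _ _ _ _ _ _ _ h n2 n3 n1 d23 d12.symm d13.symm ?_ hm m2 m3 m1
    rw [← hc]; congr 1; ext; simp only [Finset.mem_insert, Finset.mem_singleton]; tauto
  · refine LP.snoc _ _ _ _ _ _ _ h n1 n3 n2 d13 d12 d23.symm ?_ hm m1 m3 m2
    rw [← hc]; congr 1; ext; simp only [Finset.mem_insert, Finset.mem_singleton]; tauto
  · exact LP.snoc _ _ _ _ _ _ _ h n1 n2 n3 d12 d13 d23 hc hm m1 m2 m3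

theorem prefix_LP {f : ℕ → V} {a : ℕ} {c : Bool} (hf : Set.InjOn f (Set.Iio (3 * a + 1)))
    (hcol : ∀ i < a, col {f (3 * i), f (3 * i + 1), f (3 * i + 2), f (3 * i + 3)} = c)
    (j : ℕ) (hj : j ≤ a) : LP col c j (f (3 * j)) (img f j) := by
  induction j with
  | zero => exact LP.nil _ _ (f_mem_img f (by omega))
  | succ j ih => exact prefix_exit hf hcol (ih (by omega)) hj _ (Or.inr (Or.inr rfl))

theorem suffix_LP {f : ℕ → V} {a : ℕ} {c : Bool} (hf : Set.InjOn f (Set.Iio (3 * a + 1)))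
    (hcol : ∀ i < a, col {f (3 * i), f (3 * i + 1), f (3 * i + 2), f (3 * i + 3)} = c)
    (s : ℕ) : ∀ (k j : ℕ) (D : Finset V), j + s = a → LP col c k (f (3 * j)) D →
      (∀ i, 3 * j < i → i ≤ 3 * a → f i ∉ D) → HasLoosePath 4 (k + s) col c := by
  induction s with
  | zero => intro k j D _ h _; exact h.has
  | succ s ih =>
    intro k j D hj h hD
    have d12 := f_ne hf (i := 3 * j + 1) (j := 3 * j + 2) (by omega) (by omega) (by omega)
    have d13 := f_ne hf (i := 3 * j + 1) (j := 3 * j + 3) (by omega) (by omega) (by omega)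
    have d23 := f_ne hf (i := 3 * j + 2) (j := 3 * j + 3) (by omega) (by omega) (by omega)
    have := ih (k + 1) (j + 1) (D ∪ {f (3 * j + 1), f (3 * j + 2), f (3 * j + 3)}) (by omega)
      (h.snoc' (hD _ (by omega) (by omega)) (hD _ (by omega) (by omega))
        (hD _ (by omega) (by omega)) d12 d13 d23 (hcol j (by omega))) (by
        intro i h1 h2
        simp only [Finset.mem_union, Finset.mem_insert, Finset.mem_singleton, not_or]
        exact ⟨hD i (by omega) h2, f_ne hf h2 (by omega) (by omega),
          f_ne hf h2 (by omega) (by omega), f_ne hf h2 (by omega) (by omega)⟩)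
    rwa [show k + 1 + s = k + (s + 1) by omega] at this

set_option maxHeartbeats 1000000 in
theorem block {f : ℕ → V} {a : ℕ} {W : Finset V} (hf : Set.InjOn f (Set.Iio (3 * a + 1)))
    (hcol : ∀ i < a, col {f (3 * i), f (3 * i + 1), f (3 * i + 2), f (3 * i + 3)} = true)
    (hW : ∀ w ∈ W, w ∉ img f a) (hno : ¬ HasLoosePath 4 (a + 1) col true)
    (j : ℕ) (hj : j + 2 ≤ a) (u : V) (hu : u ∈ img f j) (hLP : LP col true j u (img f j)) :
    ∃ E : Finset V, E.card ≤ 2 ∧ ∃ v ∈ img f (j + 2), LP col true (j + 2) v (img f (j + 2)) ∧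
      v ∉ img f j ∧ ∃ s1 s2 x t1 t2 : V, [s1, s2, x, t1, t2].Nodup ∧
      (∀ p ∈ [s1, s2, x, t1, t2], p ∈ img f (j + 2) ∧ p ≠ v ∧ (p ∉ img f j ∨ p = u)) ∧
      ∀ w ∈ W, w ∉ E → col {w, s1, s2, x} = false ∧ col {x, t1, t2, w} = false := by
  have hm : ∀ i, i ≤ 3 * (j + 2) → f i ∈ img f (j + 2) := fun i hi => f_mem_img f hi
  have hn : ∀ i, 3 * j < i → i ≤ 3 * a → f i ∉ img f j := fun i h1 h2 =>
    f_notMem_img hf (by omega) h1 h2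
  have hun : ∀ i, 3 * j < i → i ≤ 3 * a → u ≠ f i := fun i h1 h2 h => hn i h1 h2 (h ▸ hu)
  have hloc : LocalConcl col W u (f (3 * j + 1)) (f (3 * j + 2)) (f (3 * j + 3)) (f (3 * j + 4))
      (f (3 * j + 5)) (f (3 * j + 6)) := by
    apply local_lemma
    · simp only [List.nodup_cons, List.mem_cons, List.not_mem_nil, or_false, not_or,
        List.nodup_nil, not_false_eq_true, and_true]
      refine ⟨⟨?_, ?_, ?_, ?_, ?_, ?_⟩, ⟨?_, ?_, ?_, ?_, ?_⟩, ⟨?_, ?_, ?_, ?_⟩, ⟨?_, ?_, ?_⟩,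
        ⟨?_, ?_⟩, ?_⟩ <;>
      first
        | exact hun _ (by omega) (by omega)
        | exact f_ne hf (by omega) (by omega) (by omega)
    · intro p x b y d hnd hmem w1 hw1 w2 hw2 w3 hw3 h12 h13 h23 ⟨hc1, hc2, hc3⟩
      have hex : ∀ q ∈ [p, x, b, y, d], ∃ i, 3 * j < i ∧ i < 3 * j + 6 ∧ q = f i := by
        intro q hq
        have := hmem q hq
        simp only [List.mem_cons, List.not_mem_nil, or_false] at this
        rcases this with h | h | h | h | h
        · exact ⟨_, by omega, by omega, h⟩
        · exact ⟨_, by omega, by omega, h⟩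
        · exact ⟨_, by omega, by omega, h⟩
        · exact ⟨_, by omega, by omega, h⟩
        · exact ⟨_, by omega, by omega, h⟩
      have hq : ∀ q ∈ [p, x, b, y, d], q ∉ img f j ∧ q ∉ W ∧
          ∀ i, 3 * j + 6 ≤ i → i ≤ 3 * a → f i ≠ q := by
        intro q hq
        obtain ⟨i, h1, h2, rfl⟩ := hex q hq
        exact ⟨hn i h1 (by omega), fun h => hW _ h (f_mem_img f (by omega)),
          fun k h3 h4 => f_ne hf h4 (by omega) (by omega)⟩
      have hWn : ∀ w ∈ W, ∀ i, i ≤ 3 * a → f i ≠ w := fun w hw i hi h =>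
        hW w hw (h ▸ f_mem_img f hi)
      have hWj : ∀ w ∈ W, w ∉ img f j := fun w hw h => hW w hw (img_mono f (by omega) h)
      clear hmem hex
      simp only [List.nodup_cons, List.mem_cons, List.not_mem_nil, or_false, not_or,
        List.nodup_nil, not_false_eq_true, and_true, forall_eq_or_imp, forall_eq] at hnd hq
      obtain ⟨⟨n1, n2, n3, n4⟩, ⟨n5, n6, n7⟩, ⟨n8, n9⟩, n10⟩ := hnd
      obtain ⟨⟨p1, p2, p3⟩, ⟨x1, x2, x3⟩, ⟨b1, b2, b3⟩, ⟨y1, y2, y3⟩, ⟨d1, d2, d3⟩⟩ := hq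
      have e1 : LP col true (j + 1) x (img f j ∪ {p, w1, x}) := by
        refine LP.snoc' hLP p1 (hWj _ hw1) x1 ?_ n1 ?_ ?_
        · rintro rfl; exact p2 hw1
        · rintro rfl; exact x2 hw1
        · rw [← hc1, perm1]
      have e2 : LP col true (j + 2) y (img f j ∪ {p, w1, x} ∪ {b, w2, y}) := by
        refine LP.snoc' e1 ?_ ?_ ?_ ?_ n8 ?_ ?_
        · simp only [Finset.mem_union, Finset.mem_insert, Finset.mem_singleton, not_or]
          refine ⟨b1, fun h => n2 h.symm, ?_, fun h => n5 h.symm⟩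
          rintro rfl; exact b2 hw1
        · simp only [Finset.mem_union, Finset.mem_insert, Finset.mem_singleton, not_or]
          refine ⟨hWj _ hw2, ?_, h12.symm, ?_⟩
          · rintro rfl; exact p2 hw2
          · rintro rfl; exact x2 hw2
        · simp only [Finset.mem_union, Finset.mem_insert, Finset.mem_singleton, not_or]
          refine ⟨y1, fun h => n3 h.symm, ?_, fun h => n6 h.symm⟩
          rintro rfl; exact y2 hw1
        · rintro rfl; exact b2 hw2
        · rintro rfl; exact y2 hw2
        · rw [← hc2, perm1]
      have e3 : LP col true (j + 3) (f (3 * (j + 2)))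
          (img f j ∪ {p, w1, x} ∪ {b, w2, y} ∪ {d, w3, f (3 * (j + 2))}) := by
        refine LP.snoc' e2 ?_ ?_ ?_ ?_ ?_ ?_ ?_
        · simp only [Finset.mem_union, Finset.mem_insert, Finset.mem_singleton, not_or]
          refine ⟨⟨d1, fun h => n4 h.symm, ?_, fun h => n7 h.symm⟩, fun h => n9 h.symm, ?_,
            fun h => n10 h.symm⟩
          · rintro rfl; exact d2 hw1
          · rintro rfl; exact d2 hw2
        · simp only [Finset.mem_union, Finset.mem_insert, Finset.mem_singleton, not_or]
          refine ⟨⟨hWj _ hw3, ?_, h13.symm, ?_⟩, ?_, h23.symm, ?_⟩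
          · rintro rfl; exact p2 hw3
          · rintro rfl; exact x2 hw3
          · rintro rfl; exact b2 hw3
          · rintro rfl; exact y2 hw3
        · simp only [Finset.mem_union, Finset.mem_insert, Finset.mem_singleton, not_or]
          exact ⟨⟨hn _ (by omega) (by omega), p3 _ (by omega) (by omega),
            hWn _ hw1 _ (by omega), x3 _ (by omega) (by omega)⟩, b3 _ (by omega) (by omega),
            hWn _ hw2 _ (by omega), y3 _ (by omega) (by omega)⟩
        · rintro rfl; exact d2 hw3
        · exact (d3 _ (by omega) (by omega)).symm
        · exact (hWn _ hw3 _ (by omega)).symm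
        · rw [← hc3, perm1, show 3 * (j + 2) = 3 * j + 6 by omega]
      have := suffix_LP hf hcol (a - (j + 2)) _ _ _ (by omega) e3 (by
        intro i h1 h2
        simp only [Finset.mem_union, Finset.mem_insert, Finset.mem_singleton, not_or]
        exact ⟨⟨⟨hn _ (by omega) (by omega), p3 _ (by omega) (by omega),
            hWn _ hw1 _ (by omega), x3 _ (by omega) (by omega)⟩, b3 _ (by omega) (by omega),
            hWn _ hw2 _ (by omega), y3 _ (by omega) (by omega)⟩, d3 _ (by omega) (by omega),
            hWn _ hw3 _ (by omega), f_ne hf h2 (by omega) (by omega)⟩)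
      rw [show j + 3 + (a - (j + 2)) = a + 1 by omega] at this
      exact hno this
  obtain ⟨E, hE, v, hv, s1, s2, x, t1, t2, hnd, hmem, hblue⟩ := hloc
  have hpre := prefix_LP hf hcol (j + 1) (by omega)
  have hv' : ∃ i, 3 * j < i ∧ i ≤ 3 * j + 6 ∧ v = f i := by
    rcases hv with h | h | h
    · exact ⟨_, by omega, by omega, h⟩
    · exact ⟨_, by omega, by omega, h⟩
    · exact ⟨_, by omega, by omega, h⟩
  refine ⟨E, hE, v, ?_, ?_, ?_, s1, s2, x, t1, t2, hnd, ?_, hblue⟩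
  · obtain ⟨i, h1, h2, rfl⟩ := hv'
    exact hm _ (by omega)
  · exact prefix_exit hf hcol hpre (by omega) v hv
  · obtain ⟨i, h1, h2, rfl⟩ := hv'
    exact hn _ h1 (by omega)
  · intro p hp
    obtain ⟨h1, h2⟩ := hmem p hp
    have h3 : p = u ∨ ∃ i, 3 * j < i ∧ i ≤ 3 * j + 6 ∧ p = f i := by
      simp only [List.mem_cons, List.not_mem_nil, or_false] at h1
      rcases h1 with h | h | h | h | h | h | h
      · exact Or.inl h
      all_goals exact Or.inr ⟨_, by omega, by omega, h⟩
    rcases h3 with rfl | ⟨i, h3, h4, rfl⟩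
    · exact ⟨img_mono f (by omega) hu, h2, Or.inr rfl⟩
    · exact ⟨hm _ (by omega), h2, Or.inl (hn _ h3 (by omega))⟩

theorem extend {ℓ : ℕ} {w w' : V} {D E' : Finset V} {W : Finset V} {s1 s2 x t1 t2 : V}
    (h : LP col false ℓ w D) (hnd : [s1, s2, x, t1, t2].Nodup)
    (hD : ∀ p ∈ [s1, s2, x, t1, t2], p ∉ D) (hpw : ∀ p ∈ [s1, s2, x, t1, t2], p ∉ W)
    (hb : ∀ w ∈ W, w ∉ E' → col {w, s1, s2, x} = false ∧ col {x, t1, t2, w} = false)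
    (hw : w ∈ W) (hwE : w ∉ E') (hw' : w' ∈ W) (hwE' : w' ∉ E') (hwD : w' ∉ D) :
    LP col false (ℓ + 2) w' (D ∪ {s1, s2, x, t1, t2, w'}) := by
  simp only [List.nodup_cons, List.mem_cons, List.not_mem_nil, or_false, not_or,
    List.nodup_nil, not_false_eq_true, and_true, forall_eq_or_imp, forall_eq] at hnd hD hpw
  obtain ⟨⟨n1, n2, n3, n4⟩, ⟨n5, n6, n7⟩, ⟨n8, n9⟩, n10⟩ := hnd
  obtain ⟨q1, q2, q3, q4, q5⟩ := hD
  obtain ⟨r1, r2, r3, r4, r5⟩ := hpw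
  have e1 : LP col false (ℓ + 1) x (D ∪ {s1, s2, x}) :=
    h.snoc' q1 q2 q3 n1 n2 n5 (hb w hw hwE).1
  refine (LP.snoc' e1 (x := t1) (y := t2) (z := w') ?_ ?_ ?_ n10 ?_ ?_ (hb w' hw' hwE').2).mono ?_
  · simp only [Finset.mem_union, Finset.mem_insert, Finset.mem_singleton, not_or]
    exact ⟨q4, fun h => n3 h.symm, fun h => n6 h.symm, fun h => n8 h.symm⟩
  · simp only [Finset.mem_union, Finset.mem_insert, Finset.mem_singleton, not_or]
    exact ⟨q5, fun h => n4 h.symm, fun h => n7 h.symm, fun h => n9 h.symm⟩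
  · simp only [Finset.mem_union, Finset.mem_insert, Finset.mem_singleton, not_or]
    exact ⟨hwD, fun h => r1 (h ▸ hw'), fun h => r2 (h ▸ hw'), fun h => r3 (h ▸ hw')⟩
  · exact fun h => r4 (h ▸ hw')
  · exact fun h => r5 (h ▸ hw')
  · intro p
    simp only [Finset.mem_union, Finset.mem_insert, Finset.mem_singleton]
    tauto

theorem end_fact {f : ℕ → V} {a : ℕ} {W : Finset V} (hW : ∀ w ∈ W, w ∉ img f a)
    (hno : ¬ HasLoosePath 4 (a + 1) col true) {v : V} (h : LP col true a v (img f a))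
    {w1 w2 w3 : V} (h1 : w1 ∈ W) (h2 : w2 ∈ W) (h3 : w3 ∈ W) (h12 : w1 ≠ w2) (h13 : w1 ≠ w3)
    (h23 : w2 ≠ w3) : col {v, w1, w2, w3} = false := by
  by_contra hc
  refine hno (LP.has (h.snoc' (hW _ h1) (hW _ h2)
    (hW _ h3) h12 h13 h23 ?_))
  simpa using hc
end

section
variable {V : Type*} [DecidableEq V] {col : Finset V → Bool}

/-- invariant of the blue path construction -/
def PInv (col : Finset V → Bool) (f : ℕ → V) (W : Finset V) (j ℓ q : ℕ) : Prop :=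
  ∃ Q : Finset V, Q ⊆ W ∧ Q.card ≤ q ∧ ∃ E : Finset V, E.card ≤ 2 ∧ ∃ u ∈ img f j,
    LP col true j u (img f j) ∧ ∀ w ∈ W, w ∉ Q → w ∉ E →
      LP col false ℓ w ((img f j).erase u ∪ Q ∪ {w})

theorem exists_three {U E : Finset V} (hE : E.card ≤ 2) (hU : 3 ≤ U.card) :
    ∃ w ∈ U, w ∉ E ∧ ∃ u1 ∈ U, ∃ u2 ∈ U, w ≠ u1 ∧ w ≠ u2 ∧ u1 ≠ u2 := by
  obtain ⟨w, hw, hwE⟩ := Finset.exists_mem_notMem_of_card_lt_card (show E.card < U.card by omega)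
  have h1 : 1 < (U.erase w).card := by
    rw [Finset.card_erase_of_mem hw]; omega
  obtain ⟨u1, h1, u2, h2, h12⟩ := Finset.one_lt_card.1 h1
  rw [Finset.mem_erase] at h1 h2
  exact ⟨w, hw, hwE, u1, h1.2, u2, h2.2, h1.1.symm, h2.1.symm, h12⟩

theorem exists_six {U E : Finset V} (hE : E.card ≤ 2) (hU : 6 ≤ U.card) :
    ∃ w ∈ U, w ∉ E ∧ ∃ u1 ∈ U, ∃ u2 ∈ U, ∃ u3 ∈ U, ∃ u4 ∈ U, ∃ u5 ∈ U,
      [w, u1, u2, u3, u4, u5].Nodup := by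
  obtain ⟨w, hw, hwE, u1, h1, u2, h2, a1, a2, a3⟩ := exists_three hE (show 3 ≤ U.card by omega)
  have hc : 3 ≤ (U \ {w, u1, u2}).card := by
    have := Finset.le_card_sdiff {w, u1, u2} U
    have := Finset.card_le_three (a := w) (b := u1) (c := u2)
    omega
  obtain ⟨u3, h3, -, u4, h4, u5, h5, b1, b2, b3⟩ :=
    exists_three (E := ∅) (by simp) hc
  simp only [Finset.mem_sdiff, Finset.mem_insert, Finset.mem_singleton, not_or] at h3 h4 h5
  refine ⟨w, hw, hwE, u1, h1, u2, h2, u3, h3.1, u4, h4.1, u5, h5.1, ?_⟩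
  simp only [List.nodup_cons, List.mem_cons, List.not_mem_nil, or_false, not_or,
    List.nodup_nil, not_false_eq_true, and_true]
  grind

/-- standing hypotheses -/
structure Setup (col : Finset V → Bool) (f : ℕ → V) (a : ℕ) (W : Finset V) : Prop where
  hf : Set.InjOn f (Set.Iio (3 * a + 1))
  hcol : ∀ i < a, col {f (3 * i), f (3 * i + 1), f (3 * i + 2), f (3 * i + 3)} = true
  hW : ∀ w ∈ W, w ∉ img f a
  hno : ¬ HasLoosePath 4 (a + 1) col true

theorem Setup.notMem {f : ℕ → V} {a : ℕ} {W : Finset V} (S : Setup col f a W) {j : ℕ}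
    (hj : j ≤ a) {p : V} (hp : p ∈ img f j) : p ∉ W := fun h =>
  S.hW p h (img_mono f hj hp)

/-- one step, or we are stuck with few vertices left and a special ending -/
theorem Setup.step {f : ℕ → V} {a : ℕ} {W : Finset V} (S : Setup col f a W) {j ℓ q : ℕ}
    (hI : PInv col f W j ℓ q) (hj : j + 2 ≤ a) (hq : q + 4 ≤ W.card) :
    PInv col f W (j + 2) (ℓ + 2) (q + 1) ∨
      (W.card = q + 4 ∧ (a = j + 2 → HasLoosePath 4 (ℓ + 3) col false)) := by
  obtain ⟨Q, hQW, hQ, E, hE, u, hu, hLP, hpath⟩ := hI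
  obtain ⟨E', hE', v, hv, hLP', hvj, s1, s2, x, t1, t2, hnd, hmem, hblue⟩ :=
    block S.hf S.hcol S.hW S.hno j hj u hu hLP
  have hpW : ∀ p ∈ [s1, s2, x, t1, t2], p ∉ W := fun p hp => S.notMem hj (hmem p hp).1
  have hpj : ∀ p ∈ [s1, s2, x, t1, t2], p ∉ (img f j).erase u := by
    intro p hp h
    rw [Finset.mem_erase] at h
    rcases (hmem p hp).2.2 with h' | h'
    · exact h' h.2
    · exact h.1 h'
  have hWj : ∀ w ∈ W, w ∉ img f j := fun w hw h => S.notMem (by omega) h hw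
  have hWj2 : ∀ w ∈ W, w ∉ img f (j + 2) := fun w hw h => S.notMem (by omega) h hw
  have hsub : (img f j).erase u ⊆ (img f (j + 2)).erase v := by
    intro p hp
    rw [Finset.mem_erase] at hp ⊢
    exact ⟨fun h => hvj (h ▸ hp.2), img_mono f (by omega) hp.2⟩
  by_cases hex : ∃ w ∈ W, w ∉ Q ∧ w ∉ E ∧ w ∉ E'
  · left
    obtain ⟨w, hw, hwQ, hwE, hwE'⟩ := hex
    refine ⟨insert w Q, Finset.insert_subset hw hQW, ?_, E', hE', v, hv, hLP', ?_⟩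
    · exact (Finset.card_insert_le _ _).trans (by omega)
    · intro w' hw' hwQ' hwE''
      rw [Finset.mem_insert, not_or] at hwQ'
      refine (extend (hpath w hw hwQ hwE) hnd ?_ hpW hblue hw hwE' hw' hwE'' ?_).mono ?_
      · intro p hp
        simp only [Finset.mem_union, Finset.mem_singleton, not_or]
        exact ⟨⟨hpj p hp, fun h => hpW p hp (hQW h)⟩, fun h => hpW p hp (h ▸ hw)⟩
      · simp only [Finset.mem_union, Finset.mem_singleton, not_or]
        exact ⟨⟨fun h => hWj _ hw' (Finset.mem_of_mem_erase h), hwQ'.2⟩, hwQ'.1⟩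
      · intro p hp
        have hm : ∀ p ∈ [s1, s2, x, t1, t2], p ∈ (img f (j + 2)).erase v := fun p hp =>
          Finset.mem_erase.2 ⟨(hmem p hp).2.1, (hmem p hp).1⟩
        simp only [List.mem_cons, List.not_mem_nil, or_false] at hm
        simp only [Finset.mem_union, Finset.mem_singleton, Finset.mem_insert] at hp ⊢
        rcases hp with ((hp | hp) | hp) | hp | hp | hp | hp | hp | hp
        · exact Or.inl (Or.inl (hsub hp))
        · exact Or.inl (Or.inr (Or.inr hp))
        · exact Or.inl (Or.inr (Or.inl hp))
        · exact Or.inl (Or.inl (hm _ (by tauto)))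
        · exact Or.inl (Or.inl (hm _ (by tauto)))
        · exact Or.inl (Or.inl (hm _ (by tauto)))
        · exact Or.inl (Or.inl (hm _ (by tauto)))
        · exact Or.inl (Or.inl (hm _ (by tauto)))
        · exact Or.inr hp
  · right
    push Not at hex
    have hU : W \ Q ⊆ E ∪ E' := by
      intro w hw
      rw [Finset.mem_sdiff] at hw
      rw [Finset.mem_union]
      by_cases h : w ∈ E
      · exact Or.inl h
      · exact Or.inr (hex w hw.1 hw.2 h)
    have hc1 := Finset.card_le_card hU
    have hc2 := Finset.card_union_le E E'
    have hc3 := Finset.le_card_sdiff Q W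
    refine ⟨by omega, fun haj => ?_⟩
    have hUE : 1 < ((W \ Q) \ E).card := by
      have := Finset.le_card_sdiff E (W \ Q)
      omega
    have hUE' : 1 < ((W \ Q) \ E').card := by
      have := Finset.le_card_sdiff E' (W \ Q)
      omega
    obtain ⟨r, hr, s, hs, hrs⟩ := Finset.one_lt_card.1 hUE
    obtain ⟨p, hp, q', hq', hpq⟩ := Finset.one_lt_card.1 hUE'
    simp only [Finset.mem_sdiff] at hr hs hp hq'
    have hpE : p ∈ E := by
      by_contra h; exact hp.2 (hex p hp.1.1 hp.1.2 h)
    have hqE : q' ∈ E := by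
      by_contra h; exact hq'.2 (hex q' hq'.1.1 hq'.1.2 h)
    have hrp : r ≠ p := fun h => hr.2 (h ▸ hpE)
    have hrq : r ≠ q' := fun h => hr.2 (h ▸ hqE)
    have hsp : s ≠ p := fun h => hs.2 (h ▸ hpE)
    have hsq : s ≠ q' := fun h => hs.2 (h ▸ hqE)
    subst haj
    have hvW : v ∉ W := S.notMem le_rfl hv
    have e1 : LP col false (ℓ + 1) p ((img f j).erase u ∪ Q ∪ {r} ∪ {s, v, p}) := by
      refine LP.snoc' (hpath r hr.1.1 hr.1.2 hr.2) ?_ ?_ ?_ ?_ hsp ?_ ?_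
      · simp only [Finset.mem_union, Finset.mem_singleton, not_or]
        exact ⟨⟨fun h => hWj _ hs.1.1 (Finset.mem_of_mem_erase h), hs.1.2⟩, hrs.symm⟩
      · simp only [Finset.mem_union, Finset.mem_singleton, not_or]
        exact ⟨⟨fun h => hvj (Finset.mem_of_mem_erase h), fun h => hvW (hQW h)⟩,
          fun h => hvW (h ▸ hr.1.1)⟩
      · simp only [Finset.mem_union, Finset.mem_singleton, not_or]
        exact ⟨⟨fun h => hWj _ hp.1.1 (Finset.mem_of_mem_erase h), hp.1.2⟩, hrp.symm⟩
      · exact fun h => hvW (h ▸ hs.1.1)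
      · exact fun h => hvW (h ▸ hp.1.1)
      · rw [← end_fact S.hW S.hno hLP' hr.1.1 hs.1.1 hp.1.1 hrs hrp hsp, perm1]
    refine (extend e1 hnd ?_ hpW hblue hp.1.1 hp.2 hq'.1.1 hq'.2 ?_).has
    · intro y hy
      simp only [Finset.mem_union, Finset.mem_singleton, Finset.mem_insert, not_or]
      exact ⟨⟨⟨hpj y hy, fun h => hpW y hy (hQW h)⟩, fun h => hpW y hy (h ▸ hr.1.1)⟩,
        fun h => hpW y hy (h ▸ hs.1.1), (hmem y hy).2.1, fun h => hpW y hy (h ▸ hp.1.1)⟩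
    · simp only [Finset.mem_union, Finset.mem_singleton, Finset.mem_insert, not_or]
      exact ⟨⟨⟨fun h => hWj _ hq'.1.1 (Finset.mem_of_mem_erase h), hq'.1.2⟩, hrq.symm⟩,
        hsq.symm, fun h => hvW (h ▸ hq'.1.1), hpq.symm⟩

theorem Setup.finish3 {f : ℕ → V} {a : ℕ} {W : Finset V} (S : Setup col f a W) (s : ℕ) :
    ∀ j ℓ q : ℕ, PInv col f W j ℓ q → j + 2 * s = a → q + s + 3 ≤ W.card →
      HasLoosePath 4 (ℓ + 2 * s + 1) col false := by
  induction s with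
  | zero =>
    intro j ℓ q hI hj hc
    obtain ⟨Q, hQW, hQ, E, hE, u, hu, hLP, hpath⟩ := hI
    have hja : j = a := by omega
    subst hja
    have := Finset.le_card_sdiff Q W
    obtain ⟨w, hw, hwE, u1, h1, u2, h2, d1, d2, d3⟩ :=
      exists_three hE (show 3 ≤ (W \ Q).card by omega)
    rw [Finset.mem_sdiff] at hw h1 h2
    have huW : u ∉ W := S.notMem le_rfl hu
    refine (LP.snoc' (hpath w hw.1 hw.2 hwE) (x := u1) (y := u2) (z := u) ?_ ?_ ?_ d3 ?_ ?_ ?_).has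
    · simp only [Finset.mem_union, Finset.mem_singleton, not_or]
      exact ⟨⟨fun h => S.hW _ h1.1 (Finset.mem_of_mem_erase h), h1.2⟩, d1.symm⟩
    · simp only [Finset.mem_union, Finset.mem_singleton, not_or]
      exact ⟨⟨fun h => S.hW _ h2.1 (Finset.mem_of_mem_erase h), h2.2⟩, d2.symm⟩
    · simp only [Finset.mem_union, Finset.mem_singleton, not_or]
      exact ⟨⟨fun h => Finset.notMem_erase _ _ h, fun h => huW (hQW h)⟩, fun h => huW (h ▸ hw.1)⟩
    · exact fun h => huW (h ▸ h1.1)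
    · exact fun h => huW (h ▸ h2.1)
    · rw [← end_fact S.hW S.hno hLP hw.1 h1.1 h2.1 d1 d2 d3, perm2]
  | succ s ih =>
    intro j ℓ q hI hj hc
    rcases S.step hI (by omega) (by omega) with h | ⟨h1, h2⟩
    · have := ih _ _ _ h (by omega) (by omega)
      rwa [show ℓ + 2 + 2 * s + 1 = ℓ + 2 * (s + 1) + 1 by omega] at this
    · have hs : s = 0 := by omega
      subst hs
      exact h2 (by omega)

theorem Setup.finish6 {f : ℕ → V} {a : ℕ} {W : Finset V} (S : Setup col f a W) (s : ℕ) :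
    ∀ j ℓ q : ℕ, PInv col f W j ℓ q → j + 2 * s = a → q + s + 6 ≤ W.card →
      HasLoosePath 4 (ℓ + 2 * s + 2) col false := by
  induction s with
  | zero =>
    intro j ℓ q hI hj hc
    obtain ⟨Q, hQW, hQ, E, hE, u, hu, hLP, hpath⟩ := hI
    have hja : j = a := by omega
    subst hja
    have := Finset.le_card_sdiff Q W
    obtain ⟨w, hw, hwE, u1, h1, u2, h2, u3, h3, u4, h4, u5, h5, hnd⟩ :=
      exists_six hE (show 6 ≤ (W \ Q).card by omega)
    simp only [List.nodup_cons, List.mem_cons, List.not_mem_nil, or_false, not_or,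
      List.nodup_nil, not_false_eq_true, and_true] at hnd
    obtain ⟨⟨d1, d2, d3, d4, d5⟩, ⟨f2, f3, f4, f5⟩, ⟨g3, g4, g5⟩, ⟨k4, k5⟩, l5⟩ := hnd
    rw [Finset.mem_sdiff] at hw h1 h2 h3 h4 h5
    have huW : u ∉ W := S.notMem le_rfl hu
    have e1 : LP col false (ℓ + 1) u ((img f j).erase u ∪ Q ∪ {w} ∪ {u1, u2, u}) := by
      refine LP.snoc' (hpath w hw.1 hw.2 hwE) ?_ ?_ ?_ f2 ?_ ?_ ?_
      · simp only [Finset.mem_union, Finset.mem_singleton, not_or]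
        exact ⟨⟨fun h => S.hW _ h1.1 (Finset.mem_of_mem_erase h), h1.2⟩, fun h => d1 h.symm⟩
      · simp only [Finset.mem_union, Finset.mem_singleton, not_or]
        exact ⟨⟨fun h => S.hW _ h2.1 (Finset.mem_of_mem_erase h), h2.2⟩, fun h => d2 h.symm⟩
      · simp only [Finset.mem_union, Finset.mem_singleton, not_or]
        exact ⟨⟨fun h => Finset.notMem_erase _ _ h, fun h => huW (hQW h)⟩,
          fun h => huW (h ▸ hw.1)⟩
      · exact fun h => huW (h ▸ h1.1)
      · exact fun h => huW (h ▸ h2.1)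
      · rw [← end_fact S.hW S.hno hLP hw.1 h1.1 h2.1 d1 d2 f2, perm2]
    refine (LP.snoc' e1 ?_ ?_ ?_ k4 k5 l5
      (end_fact S.hW S.hno hLP h3.1 h4.1 h5.1 k4 k5 l5)).has
    · simp only [Finset.mem_union, Finset.mem_singleton, Finset.mem_insert, not_or]
      exact ⟨⟨⟨fun h => S.hW _ h3.1 (Finset.mem_of_mem_erase h), h3.2⟩, fun h => d3 h.symm⟩,
        fun h => f3 h.symm, fun h => g3 h.symm, fun h => huW (h ▸ h3.1)⟩
    · simp only [Finset.mem_union, Finset.mem_singleton, Finset.mem_insert, not_or]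
      exact ⟨⟨⟨fun h => S.hW _ h4.1 (Finset.mem_of_mem_erase h), h4.2⟩, fun h => d4 h.symm⟩,
        fun h => f4 h.symm, fun h => g4 h.symm, fun h => huW (h ▸ h4.1)⟩
    · simp only [Finset.mem_union, Finset.mem_singleton, Finset.mem_insert, not_or]
      exact ⟨⟨⟨fun h => S.hW _ h5.1 (Finset.mem_of_mem_erase h), h5.2⟩, fun h => d5 h.symm⟩,
        fun h => f5 h.symm, fun h => g5 h.symm, fun h => huW (h ▸ h5.1)⟩
  | succ s ih =>
    intro j ℓ q hI hj hc
    rcases S.step hI (by omega) (by omega) with h | ⟨h1, h2⟩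
    · have := ih _ _ _ h (by omega) (by omega)
      rwa [show ℓ + 2 + 2 * s + 2 = ℓ + 2 * (s + 1) + 2 by omega] at this
    · omega

theorem Setup.start {f : ℕ → V} {a : ℕ} {W : Finset V} (S : Setup col f a W) (j : ℕ)
    (hj : j ≤ a) : PInv col f W j 0 0 :=
  ⟨∅, by simp, by simp, ∅, by simp, f (3 * j), f_mem_img f le_rfl, prefix_LP S.hf S.hcol j hj,
    fun w _ _ _ => LP.nil _ _ (by simp)⟩

theorem Setup.start1 {f : ℕ → V} {a : ℕ} {W : Finset V} (S : Setup col f a W) (j : ℕ)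
    (hj : j + 2 ≤ a) : PInv col f W (j + 2) 1 0 := by
  obtain ⟨E', hE', v, hv, hLP', hvj, s1, s2, x, t1, t2, hnd, hmem, hblue⟩ :=
    block S.hf S.hcol S.hW S.hno j hj (f (3 * j)) (f_mem_img f le_rfl)
      (prefix_LP S.hf S.hcol j (by omega))
  refine ⟨∅, by simp, by simp, E', hE', v, hv, hLP', fun w hw _ hwE => ?_⟩
  have hpW : ∀ p ∈ [s1, s2, x, t1, t2], p ≠ w := fun p hp h =>
    S.notMem hj (hmem p hp).1 (h ▸ hw)
  have hm : ∀ p ∈ [s1, s2, x, t1, t2], p ∈ (img f (j + 2)).erase v := fun p hp =>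
          Finset.mem_erase.2 ⟨(hmem p hp).2.1, (hmem p hp).1⟩
  simp only [List.nodup_cons, List.mem_cons, List.not_mem_nil, or_false, not_or,
    List.nodup_nil, not_false_eq_true, and_true, forall_eq_or_imp, forall_eq] at hnd hpW hm
  refine LP.snoc 0 x t1 t2 w {x} _ (LP.nil _ _ (by simp)) ?_ ?_ ?_ hnd.2.2.2 hpW.2.2.2.1
    hpW.2.2.2.2 (hblue w hw hwE).2 ?_ ?_ ?_ ?_
  · rw [Finset.mem_singleton]; exact fun h => hnd.2.2.1.1 h.symm
  · rw [Finset.mem_singleton]; exact fun h => hnd.2.2.1.2 h.symm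
  · rw [Finset.mem_singleton]; exact fun h => hpW.2.2.1 h.symm
  · rw [Finset.singleton_subset_iff]
    exact Finset.mem_union_left _ (Finset.mem_union_left _ hm.2.2.1)
  · exact Finset.mem_union_left _ (Finset.mem_union_left _ hm.2.2.2.1)
  · exact Finset.mem_union_left _ (Finset.mem_union_left _ hm.2.2.2.2)
  · simp

theorem Setup.core2 {f : ℕ → V} {a : ℕ} {W : Finset V} (S : Setup col f a W) (T : ℕ)
    (hT : 2 * T ≤ a) (hW : T + 3 ≤ W.card) : HasLoosePath 4 (2 * T + 1) col false := by
  have := S.finish3 T (a - 2 * T) 0 0 (S.start _ (by omega)) (by omega) (by omega)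
  rwa [Nat.zero_add] at this

theorem Setup.core3 {f : ℕ → V} {a : ℕ} {W : Finset V} (S : Setup col f a W) (T : ℕ)
    (hT : 2 * T ≤ a) (hW : T + 6 ≤ W.card) : HasLoosePath 4 (2 * T + 2) col false := by
  have := S.finish6 T (a - 2 * T) 0 0 (S.start _ (by omega)) (by omega) (by omega)
  rwa [Nat.zero_add] at this

theorem Setup.core1 {f : ℕ → V} {a : ℕ} {W : Finset V} (S : Setup col f a W) (T : ℕ)
    (hT1 : 1 ≤ T) (hT : 2 * T ≤ a) (hW : T + 2 ≤ W.card) :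
    HasLoosePath 4 (2 * T) col false := by
  have := S.finish3 (T - 1) (a - 2 * T + 2) 1 0 (S.start1 _ (by omega)) (by omega) (by omega)
  rwa [show 1 + 2 * (T - 1) + 1 = 2 * T by omega] at this

/-- maximal red path gives a setup -/
theorem exists_setup [Fintype V] {a : ℕ} (ha : HasLoosePath 4 a col true)
    (hno : ¬ HasLoosePath 4 (a + 1) col true) :
    ∃ (f : ℕ → V) (W : Finset V), Setup col f a W ∧ W.card + (3 * a + 1) = Fintype.card V := by
  obtain ⟨f, hf, hcol⟩ := (hasLoosePath_iff a).1 ha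
  refine ⟨f, (img f a)ᶜ, ⟨hf, hcol, fun w hw => Finset.mem_compl.1 hw, hno⟩, ?_⟩
  have h1 : (img f a).card = 3 * a + 1 := by
    unfold img
    rw [Finset.card_image_of_injOn, Finset.card_range]
    intro i hi j hj h
    simp only [Finset.coe_range] at hi hj
    exact hf hi hj h
  rw [← h1, add_comm, Finset.card_add_card_compl]

theorem hasLoosePath_not {n : ℕ} {c : Bool} :
    HasLoosePath 4 n (fun s => !col s) c ↔ HasLoosePath 4 n col (!c) := by
  unfold HasLoosePath
  have : ∀ b : Bool, ((!b) = c) ↔ (b = !c) := by intro b; cases b <;> cases c <;> simp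
  simp only [this]

theorem exists_max {c : Bool} [Nonempty V] {n : ℕ} (hn : ¬ HasLoosePath 4 n col c) :
    ∃ a, a < n ∧ HasLoosePath 4 a col c ∧ ¬ HasLoosePath 4 (a + 1) col c := by
  induction n with
  | zero =>
    exfalso
    obtain ⟨v⟩ := ‹Nonempty V›
    exact hn (LP.nil v {v} (by simp) : LP col c 0 v {v}).has
  | succ n ih =>
    by_cases h : HasLoosePath 4 n col c
    · exact ⟨n, by omega, h, hn⟩
    · obtain ⟨a, h1, h2, h3⟩ := ih h
      exact ⟨a, by omega, h2, h3⟩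

/-- final diagonal contradiction: `c` is a maximal red length and there is no blue `P_{c+1}` -/
theorem diag [Fintype V] {n m c : ℕ} (hm : 3 ≤ m) (hnm : m ≤ n) (h : m + 2 ≤ n ∨ Odd n)
    (hV : Fintype.card V = 3 * n + (m + 1) / 2) (hcm : c < m) (hc : HasLoosePath 4 c col true)
    (hno : ¬ HasLoosePath 4 (c + 1) col true) : HasLoosePath 4 (c + 1) col false := by
  obtain ⟨f, W, S, hcard⟩ := exists_setup hc hno
  rcases Nat.even_or_odd' c with ⟨t, ht | ht⟩
  · have := S.core2 t (by omega) (by omega)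
    rwa [← ht] at this
  · have hn : c + 2 ≤ n := by
      rcases h with h | ⟨k, hk⟩ <;> omega
    have := S.core3 t (by omega) (by omega)
    rwa [show 2 * t + 2 = c + 1 by omega] at this

theorem upper [Fintype V] [Nonempty V] {n m : ℕ} (hm : 3 ≤ m) (hnm : m ≤ n)
    (h : m + 2 ≤ n ∨ Odd n) (hV : Fintype.card V = 3 * n + (m + 1) / 2)
    (col : Finset V → Bool) : HasLoosePath 4 n col true ∨ HasLoosePath 4 m col false := by
  by_contra hcon
  push Not at hcon
  obtain ⟨hr, hb⟩ := hcon
  obtain ⟨a, ha, ha1, ha2⟩ := exists_max hr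
  obtain ⟨b, hbm, hb1, hb2⟩ := exists_max hb
  by_cases ham : m ≤ a
  · obtain ⟨f, W, S, hcard⟩ := exists_setup ha1 ha2
    rcases Nat.even_or_odd' m with ⟨t, ht | ht⟩
    · have := S.core1 t (by omega) (by omega) (by omega)
      rw [← ht] at this
      exact hb this
    · have := S.core2 t (by omega) (by omega)
      rw [← ht] at this
      exact hb this
  · rcases le_total b a with hba | hab
    · have := diag hm hnm h hV (by omega) ha1 ha2
      exact hb2 (this.mono (by omega))
    · have := diag (col := fun s => !col s) hm hnm h hV hbm (hasLoosePath_not.2 hb1)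
        (fun h' => hb2 (hasLoosePath_not.1 h'))
      exact ha2 ((hasLoosePath_not.1 this).mono (by omega))

end

theorem lower (n m N : ℕ) (hm : 3 ≤ m) (hnm : m ≤ n) (hN : N < 3 * n + (m + 1) / 2) :
    ∃ col : Finset (Fin N) → Bool,
      ¬ HasLoosePath 4 n col true ∧ ¬ HasLoosePath 4 m col false := by
  refine ⟨fun s => decide (∀ x ∈ s, x.val < 3 * n), ?_, ?_⟩
  · rw [hasLoosePath_iff]
    rintro ⟨f, hf, hc⟩
    have hlt : ∀ i < 3 * n + 1, (f i).val < 3 * n := by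
      intro i hi
      by_cases h : i < 3 * n
      · have := hc (i / 3) (by omega)
        simp only [decide_eq_true_eq] at this
        apply this
        simp only [Finset.mem_insert, Finset.mem_singleton]
        have h3 : i = 3 * (i / 3) ∨ i = 3 * (i / 3) + 1 ∨ i = 3 * (i / 3) + 2 := by omega
        rcases h3 with h3 | h3 | h3
        · left; rw [← h3]
        · right; left; rw [← h3]
        · right; right; left; rw [← h3]
      · have := hc (n - 1) (by omega)
        simp only [decide_eq_true_eq] at this
        apply this
        simp only [Finset.mem_insert, Finset.mem_singleton]
        right; right; right; congr 1; omega
    have := Finset.card_le_card_of_injOn (s := Finset.range (3 * n + 1))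
      (t := Finset.range (3 * n)) (fun i => (f i).val)
      (by intro i hi
          simp only [Finset.coe_range, Set.mem_Iio] at hi ⊢
          exact hlt i hi)
      (by intro i hi j hj hij
          simp only [Finset.coe_range] at hi hj
          exact hf hi hj (Fin.ext hij))
    simp at this
  · rw [hasLoosePath_iff]
    rintro ⟨f, hf, hc⟩
    have hex : ∀ k, k < (m + 1) / 2 → ∃ i, 6 * k ≤ i ∧ i ≤ 6 * k + 3 ∧ 3 * n ≤ (f i).val := by
      intro k hk
      have := hc (2 * k) (by omega)
      simp only [decide_eq_false_iff_not, Finset.mem_insert, Finset.mem_singleton] at this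
      push Not at this
      obtain ⟨x, hx, hx'⟩ := this
      rcases hx with rfl | rfl | rfl | rfl
      · exact ⟨_, by omega, by omega, hx'⟩
      · exact ⟨_, by omega, by omega, hx'⟩
      · exact ⟨_, by omega, by omega, hx'⟩
      · exact ⟨_, by omega, by omega, hx'⟩
    choose! g hg1 hg2 hg3 using hex
    have := Finset.card_le_card_of_injOn (s := Finset.range ((m + 1) / 2))
      (t := Finset.Ico (3 * n) N) (fun k => (f (g k)).val)
      (by intro k hk
          simp only [Finset.coe_range, Set.mem_Iio] at hk
          simp only [Finset.coe_Ico, Set.mem_Ico]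
          exact ⟨hg3 k hk, (f (g k)).isLt⟩)
      (by intro i hi j hj hij
          simp only [Finset.coe_range, Set.mem_Iio] at hi hj
          have h1 := hg1 i hi
          have h2 := hg2 i hi
          have h3 := hg1 j hj
          have h4 := hg2 j hj
          have := hf (show g i ∈ Set.Iio (3 * m + 1) by simp only [Set.mem_Iio]; omega)
            (show g j ∈ Set.Iio (3 * m + 1) by simp only [Set.mem_Iio]; omega) (Fin.ext hij)
          omega)
    rw [Finset.card_range, Nat.card_Ico] at this
    omega

/-- For n ≥ m ≥ 3 with n ≥ m + 2 ≥ 5 or n odd, R(P⁴ₙ, P⁴ₘ) = 3n + ⌊(m+1)/2⌋. -/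
theorem ramsey_P4n_P4m (n m : ℕ) (hm : 3 ≤ m) (hnm : m ≤ n)
    (h : m + 2 ≤ n ∨ Odd n) :
    RamseyPP 4 n m = 3 * n + (m + 1) / 2 := by
  have hmem : 3 * n + (m + 1) / 2 ∈ {N | 0 < N ∧ ∀ col : Finset (Fin N) → Bool,
      HasLoosePath 4 n col true ∨ HasLoosePath 4 m col false} := by
    refine ⟨by omega, fun col => ?_⟩
    haveI : Nonempty (Fin (3 * n + (m + 1) / 2)) := ⟨⟨0, by omega⟩⟩
    exact upper hm hnm h (Fintype.card_fin _) col
  unfold RamseyPP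
  apply le_antisymm (Nat.sInf_le hmem)
  apply le_csInf ⟨_, hmem⟩
  rintro N ⟨_, hN⟩
  by_contra hlt
  obtain ⟨col, h1, h2⟩ := lower n m N hm hnm (by omega)
  exact (hN col).elim h1 h2
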